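/- Let l > 1 be an integer and let K be a subgroup of SL(2, ℤ/lℤ) such that for every prime p dividing l, writing p^e for the exact power of p dividing l, the image of K under the natural reduction homomorphism SL(2, ℤ/lℤ) → SL(2, ℤ/p^eℤ) is all of SL(2, ℤ/p^eℤ). Then K = SL(2, ℤ/lℤ). -/

import Mathlib

open Matrix Pointwise

abbrev SL2 (R : Type*) [CommRing R] := Matrix.SpecialLinearGroup (Fin 2) R

/-- `A(x) = [[1,x],[0,1]]` as an element of `SL(2,R)`. -/
def Amat {R : Type*} [CommRing R] (x : R) : SL2 R :=
  ⟨!![1, x; 0, 1], by simp [Matrix.det_fin_two_of]⟩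

/-- `B(x) = [[1,0],[x,1]]` as an element of `SL(2,R)`. -/
def Bmat {R : Type*} [CommRing R] (x : R) : SL2 R :=
  ⟨!![1, 0; x, 1], by simp [Matrix.det_fin_two_of]⟩

/-- `G(x)`, the subgroup of `SL(2,R)` generated by `A(x)` and `B(x)`. -/
def Gx {R : Type*} [CommRing R] (x : R) : Subgroup (SL2 R) :=
  Subgroup.closure {Amat x, Bmat x}

section SpecialLinearTwo

variable {R : Type*} [CommRing R]

lemma coe_Amat (x : R) : (Amat x : Matrix (Fin 2) (Fin 2) R) = !![1, x; 0, 1] := rfl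

lemma coe_Bmat (x : R) : (Bmat x : Matrix (Fin 2) (Fin 2) R) = !![1, 0; x, 1] := rfl

lemma SpecialLinearGroup.apply_eq_of_map_eq {S : Type*} [CommRing S] {φ : R →+* S} {x y : SL2 R}
    (h : SpecialLinearGroup.map φ x = SpecialLinearGroup.map φ y) (i j : Fin 2) :
    φ (x i j) = φ (y i j) :=
  congrArg (fun z : SL2 S ↦ z i j) h

instance SpecialLinearGroup.subsingleton_of_ring [Subsingleton R] : Subsingleton (SL2 R) :=
  ⟨fun x y ↦ by ext i j; exact Subsingleton.elim _ _⟩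

lemma Amat_add (x y : R) : Amat (x + y) = Amat x * Amat y := by
  ext i j
  fin_cases i <;> fin_cases j <;> simp [coe_Amat, add_comm]

lemma Amat_zero : Amat (0 : R) = 1 := by
  ext i j
  fin_cases i <;> fin_cases j <;> simp [Amat]

lemma Amat_natCast (n : ℕ) : Amat (n : R) = Amat 1 ^ n := by
  induction n with
  | zero => simp [Amat_zero]
  | succ n ih => rw [Nat.cast_succ, Amat_add, ih, pow_succ]

/-- Conjugating `A(-x)` by the Weyl element `A(1) B(-1) A(1)` gives `B(x)`. -/
lemma Bmat_eq_conj (x : R) :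
    Bmat x = (Amat 1 * Bmat (-1) * Amat 1) * Amat (-x) * (Amat 1 * Bmat (-1) * Amat 1)⁻¹ := by
  rw [eq_mul_inv_iff_mul_eq]
  ext i j
  fin_cases i <;> fin_cases j <;> simp [coe_Amat, coe_Bmat]

lemma eq_Amat_mul_Bmat_mul_Amat (g : SL2 R) (u : R) (hu : g 1 0 * u = 1) :
    g = Amat ((g 0 0 - 1) * u) * Bmat (g 1 0) * Amat ((g 1 1 - 1) * u) := by
  have hdet := g.det_coe
  rw [Matrix.det_fin_two] at hdet
  ext i j
  fin_cases i <;> fin_cases j <;>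
    simp [coe_Amat, coe_Bmat] <;> grind

/-- Over a local ring, a normal subgroup of `SL(2, R)` containing all `A(x)` is everything. -/
lemma eq_top_of_Amat_mem [IsLocalRing R] (N : Subgroup (SL2 R)) [hN : N.Normal]
    (hA : ∀ x, Amat x ∈ N) : N = ⊤ := by
  have hB (x : R) : Bmat x ∈ N := by
    rw [Bmat_eq_conj]
    exact hN.conj_mem _ (hA _) _
  have key (g : SL2 R) (hg : IsUnit (g 1 0)) : g ∈ N := by
    obtain ⟨u, hu⟩ := hg.exists_right_inv
    rw [eq_Amat_mul_Bmat_mul_Amat g u hu]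
    exact mul_mem (mul_mem (hA _) (hB _)) (hA _)
  rw [eq_top_iff]
  rintro g -
  by_cases hc : IsUnit (g 1 0)
  · exact key g hc
  have hdet := g.det_coe
  rw [Matrix.det_fin_two] at hdet
  have ha : IsUnit (g 0 0) := by
    have hsum : IsUnit (g 0 0 * g 1 1 + -(g 0 1 * g 1 0)) := by
      rw [← sub_eq_add_neg, hdet]
      exact isUnit_one
    rcases IsLocalRing.isUnit_or_isUnit_of_isUnit_add hsum with h | h
    · exact isUnit_of_mul_isUnit_left h
    · exact absurd (isUnit_of_mul_isUnit_right (IsUnit.neg_iff _ |>.1 h)) hc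
  have hac : IsUnit (g 0 0 + g 1 0) := by
    have hsum : IsUnit ((g 0 0 + g 1 0) + -(g 1 0)) := by simpa using ha
    rcases IsLocalRing.isUnit_or_isUnit_of_isUnit_add hsum with h | h
    · exact h
    · exact absurd (IsUnit.neg_iff _ |>.1 h) hc
  refine (Subgroup.mul_mem_cancel_left N (hB 1)).1 (key _ ?_)
  simpa [coe_Bmat, Matrix.mul_apply, Fin.sum_univ_two] using hac

end SpecialLinearTwo

lemma ZMod.isLocalRing_prime_pow {p e : ℕ} (hp : p.Prime) (he : e ≠ 0) :
    IsLocalRing (ZMod (p ^ e)) := by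
  have : NeZero (p ^ e) := ⟨pow_ne_zero _ hp.ne_zero⟩
  have : Fact (1 < p ^ e) := ⟨Nat.one_lt_pow he hp.one_lt⟩
  have hunit (a : ZMod (p ^ e)) : ¬ IsUnit a ↔ p ∣ a.val := by
    rw [← ZMod.natCast_zmod_val a, ZMod.isUnit_iff_coprime, ZMod.natCast_zmod_val,
      Nat.coprime_pow_right_iff (Nat.pos_of_ne_zero he), Nat.coprime_comm,
      hp.coprime_iff_not_dvd, not_not]
  refine IsLocalRing.of_nonunits_add fun a b ha hb ↦ ?_
  rw [mem_nonunits_iff, hunit] at ha hb ⊢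
  rw [ZMod.val_add]
  exact (Nat.dvd_mod_iff (dvd_pow_self p he)).2 (dvd_add ha hb)

lemma ZMod.castHom_eq_zero_iff {n l : ℕ} [NeZero l] (h : n ∣ l) (z : ZMod l) :
    ZMod.castHom h (ZMod n) z = 0 ↔ n ∣ z.val := by
  rw [ZMod.castHom_apply, ZMod.cast_eq_val, ZMod.natCast_eq_zero_iff]

/-- Any homomorphism from `SL(2, ℤ/p^eℤ)` killing `A(1)` is trivial. -/
lemma monoidHom_eq_one_of_Amat {p e : ℕ} (hp : p.Prime) (he : e ≠ 0) {Q : Type*} [Group Q]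
    (g : SL2 (ZMod (p ^ e)) →* Q) (hg : g (Amat 1) = 1) (x : SL2 (ZMod (p ^ e))) : g x = 1 := by
  have := ZMod.isLocalRing_prime_pow hp he
  have : NeZero (p ^ e) := ⟨pow_ne_zero _ hp.ne_zero⟩
  have htop : g.ker = ⊤ := by
    refine eq_top_of_Amat_mem _ fun x ↦ ?_
    rw [MonoidHom.mem_ker, ← ZMod.natCast_zmod_val x, Amat_natCast, map_pow, hg, one_pow]
  exact MonoidHom.mem_ker.1 (htop ▸ Subgroup.mem_top x)

lemma Amat_one_pow_self (n : ℕ) : (Amat 1 : SL2 (ZMod n)) ^ n = 1 := by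
  rw [← Amat_natCast, ZMod.natCast_self, Amat_zero]

/-- An element of `SL(2, ℤ/q^eℤ)` congruent to `1` modulo `q` has `q`-power order. -/
lemma pow_eq_one_of_map_eq_one {q e : ℕ} (hq : q.Prime) (h : q ∣ q ^ e) (g : SL2 (ZMod (q ^ e)))
    (hg : SpecialLinearGroup.map (ZMod.castHom h (ZMod q)) g = 1) : g ^ q ^ e = 1 := by
  have : NeZero (q ^ e) := ⟨pow_ne_zero _ hq.ne_zero⟩
  have hentry (i j : Fin 2) : ∃ b : ZMod (q ^ e), g i j - (1 : SL2 (ZMod (q ^ e))) i j = q * b := by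
    have h0 : ZMod.castHom h (ZMod q) (g i j - (1 : SL2 (ZMod (q ^ e))) i j) = 0 := by
      rw [map_sub, sub_eq_zero]
      exact SpecialLinearGroup.apply_eq_of_map_eq (hg.trans (map_one _).symm) i j
    obtain ⟨b, hb⟩ := (ZMod.castHom_eq_zero_iff h _).1 h0
    exact ⟨b, by rw [← Nat.cast_mul, ← hb, ZMod.natCast_zmod_val]⟩
  choose B hB using hentry
  have hgB : g.1 = 1 + (q : Matrix (Fin 2) (Fin 2) (ZMod (q ^ e))) * Matrix.of B := by
    rw [← nsmul_eq_mul]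
    ext i j
    rw [Matrix.add_apply, Matrix.smul_apply, Matrix.of_apply, nsmul_eq_mul, ← hB]
    simp
  have hpoly : ((q : Polynomial ℤ) ^ (e + 1)) ∣
      (1 + (q : Polynomial ℤ) * Polynomial.X) ^ q ^ e - 1 ^ q ^ e :=
    dvd_sub_pow_of_dvd_sub ⟨Polynomial.X, by ring⟩ e
  obtain ⟨r, hr⟩ := hpoly
  have heval := congrArg (Polynomial.aeval (Matrix.of B)) hr
  have hzero : (q : Matrix (Fin 2) (Fin 2) (ZMod (q ^ e))) ^ (e + 1) = 0 := by
    rw [pow_succ, ← Nat.cast_pow, ← map_natCast (algebraMap (ZMod (q ^ e)) _) (q ^ e),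
      ZMod.natCast_self, map_zero, zero_mul]
  simp only [map_sub, map_pow, map_add, map_one, map_mul, map_natCast, Polynomial.aeval_X,
    one_pow, hzero, zero_mul, ← hgB, sub_eq_zero] at heval
  apply Subtype.ext
  simpa using heval

lemma natCard_SL2_zmod_dvd {k : ℕ} (hk : (k + 1).Prime) :
    Nat.card (SL2 (ZMod (k + 1))) ∣ (k * (k + 2)) * ((k + 1) * k) := by
  have : Fact (k + 1).Prime := ⟨hk⟩
  have hcard : Nat.card (GL (Fin 2) (ZMod (k + 1))) = (k * (k + 2)) * ((k + 1) * k) := by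
    rw [Matrix.card_GL_field, Fin.prod_univ_two, ZMod.card]
    congr 1
    · simp only [Fin.val_zero, pow_zero]
      rw [Nat.sub_eq_iff_eq_add (Nat.one_le_pow _ (k + 1) (by omega))]
      ring
    · simp only [Fin.val_one, pow_one]
      rw [Nat.sub_eq_iff_eq_add (by nlinarith)]
      ring
  rw [← hcard]
  exact Subgroup.card_dvd_of_injective
    (SpecialLinearGroup.toGL : SL2 (ZMod (k + 1)) →* GL (Fin 2) (ZMod (k + 1)))
    SpecialLinearGroup.toGL_injective

lemma not_dvd_card_SL2_zmod_prime {p q : ℕ} (hp : p.Prime) (hq : q.Prime) (hqp : q < p)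
    (hp3 : p ≠ 3) : ¬ p ∣ Nat.card (SL2 (ZMod q)) := by
  intro hdvd
  have hq1 := hq.one_lt
  obtain ⟨k, rfl⟩ : ∃ k, q = k + 1 := ⟨q - 1, by omega⟩
  have h := hdvd.trans (natCard_SL2_zmod_dvd hq)
  simp only [hp.dvd_mul] at h
  have hk : ¬ p ∣ k := fun h ↦ absurd (Nat.le_of_dvd (by omega) h) (by omega)
  have hk1 : ¬ p ∣ k + 1 := fun h ↦ absurd (Nat.le_of_dvd (by omega) h) (by omega)
  have hk2 : ¬ p ∣ k + 2 := by
    intro h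
    have hpk : p = k + 2 := le_antisymm (Nat.le_of_dvd (by omega) h) (by omega)
    rcases hq.eq_two_or_odd with h2 | h2
    · omega
    · rcases hp.eq_two_or_odd with h3 | h3 <;> omega
  tauto

lemma eq_one_of_map_prime_pow_eq_one {m : ℕ} [NeZero m] (g : SL2 (ZMod m))
    (hg : ∀ q k, q.Prime → ∀ h : q ^ k ∣ m,
      SpecialLinearGroup.map (ZMod.castHom h (ZMod (q ^ k))) g = 1) : g = 1 := by
  ext i j
  rw [← sub_eq_zero, ← ZMod.natCast_zmod_val (g.1 i j - _), ZMod.natCast_eq_zero_iff,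
    Nat.dvd_iff_prime_pow_dvd_dvd]
  intro q k hq h
  rw [← ZMod.castHom_eq_zero_iff h, map_sub, sub_eq_zero]
  exact SpecialLinearGroup.apply_eq_of_map_eq ((hg q k hq h).trans (map_one _).symm) i j

lemma not_dvd_card_SL2_zmod {p m : ℕ} (hp : p.Prime) (hm : m ≠ 0) (hp3 : p ≠ 3)
    (hlt : ∀ q, q.Prime → q ∣ m → q < p) : ¬ p ∣ Nat.card (SL2 (ZMod m)) := by
  intro hdvd
  have : NeZero m := ⟨hm⟩
  have : Fact p.Prime := ⟨hp⟩
  obtain ⟨g, hg⟩ := exists_prime_orderOf_dvd_card' p hdvd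
  have hgp : g ^ p = 1 := hg ▸ pow_orderOf_eq_one g
  suffices g = 1 by simp [this, hp.ne_one.symm] at hg
  refine eq_one_of_map_prime_pow_eq_one g fun q k hq h ↦ ?_
  rcases eq_or_ne k 0 with rfl | hk
  · have : Subsingleton (ZMod (q ^ 0)) := by rw [pow_zero]; infer_instance
    exact Subsingleton.elim _ _
  have hqk : q ∣ q ^ k := dvd_pow_self q hk
  have hqp := hlt q hq (hqk.trans h)
  have : NeZero q := ⟨hq.ne_zero⟩
  set x := SpecialLinearGroup.map (ZMod.castHom h (ZMod (q ^ k))) g with hx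
  have hxp : x ^ p = 1 := by rw [hx, ← map_pow, hgp, map_one]
  have hmod : SpecialLinearGroup.map (ZMod.castHom hqk (ZMod q)) x = 1 := by
    rw [← orderOf_eq_one_iff]
    refine Nat.eq_one_of_dvd_coprimes
      ((hp.coprime_iff_not_dvd).2 (not_dvd_card_SL2_zmod_prime hp hq hqp hp3)) ?_
      (orderOf_dvd_natCard _)
    rw [orderOf_dvd_iff_pow_eq_one, ← map_pow, hxp, map_one]
  rw [← orderOf_eq_one_iff]
  exact Nat.eq_one_of_dvd_coprimes (((Nat.coprime_primes hp hq).2 hqp.ne').pow_right k)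
    (orderOf_dvd_of_pow_eq_one hxp)
    (orderOf_dvd_of_pow_eq_one (pow_eq_one_of_map_eq_one hq hqk x hmod))

lemma isSolvable_SL2_zmod_two : Group.IsSolvable (SL2 (ZMod 2)) := by
  have hdvd : Nat.card (SL2 (ZMod 2)) ∣ 6 := natCard_SL2_zmod_dvd (k := 1) Nat.prime_two
  have : IsZGroup (SL2 (ZMod 2)) := IsZGroup.of_squarefree
    (Squarefree.squarefree_of_dvd hdvd ((Nat.squarefree_mul (m := 2) (n := 3) (by norm_num)).2
      ⟨Nat.prime_two.prime.squarefree, Nat.prime_three.prime.squarefree⟩))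
  infer_instance

lemma isSolvable_SL2_zmod_two_pow {a : ℕ} (ha : a ≠ 0) :
    Group.IsSolvable (SL2 (ZMod (2 ^ a))) := by
  have h : 2 ∣ 2 ^ a := dvd_pow_self 2 ha
  have : NeZero (2 ^ a) := ⟨by positivity⟩
  have : Fact (Nat.Prime 2) := ⟨Nat.prime_two⟩
  set f : SL2 (ZMod (2 ^ a)) →* SL2 (ZMod 2) := SpecialLinearGroup.map (ZMod.castHom h (ZMod 2))
  have hker : IsPGroup 2 f.ker := fun g ↦
    ⟨a, Subtype.ext (pow_eq_one_of_map_eq_one Nat.prime_two h g.1 g.2)⟩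
  have := hker.isNilpotent
  have := isSolvable_SL2_zmod_two
  exact Group.isSolvable_of_ker_le_range f.ker.subtype f (by simp)

/-- A common quotient of `SL(2, ℤ/2^aℤ)` and `SL(2, ℤ/3^eℤ)` is trivial: it is solvable, and its
abelianization is killed by both `2^a` and `3^e`. -/
lemma subsingleton_of_two_three {a e : ℕ} (ha : a ≠ 0) (he : e ≠ 0) {Q : Type*} [Group Q]
    (f : SL2 (ZMod (2 ^ a)) →* Q) (hf : Function.Surjective f)
    (g : SL2 (ZMod (3 ^ e)) →* Q) (hg : Function.Surjective g) : Subsingleton Q := by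
  have := isSolvable_SL2_zmod_two_pow ha
  have := Group.isSolvable_of_surjective hf
  have hexp {p k : ℕ} (hp : p.Prime) (hk : k ≠ 0) (φ : SL2 (ZMod (p ^ k)) →* Q)
      (hφ : Function.Surjective φ) (y : Abelianization Q) : y ^ p ^ k = 1 := by
    obtain ⟨z, rfl⟩ := (QuotientGroup.mk'_surjective (commutator Q)) y
    obtain ⟨x, rfl⟩ := hφ z
    refine monoidHom_eq_one_of_Amat hp hk
      ((powMonoidHom (p ^ k)).comp (Abelianization.of.comp φ)) ?_ x
    change Abelianization.of (φ (Amat 1)) ^ p ^ k = 1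
    rw [← map_pow, ← map_pow, Amat_one_pow_self, map_one, map_one]
  by_contra hQ
  rw [not_subsingleton_iff_nontrivial] at hQ
  refine (Group.IsSolvable.commutator_lt_top_of_nontrivial Q).ne ?_
  rw [eq_top_iff]
  rintro x -
  rw [← Abelianization.ker_of, MonoidHom.mem_ker, ← orderOf_eq_one_iff]
  exact Nat.eq_one_of_dvd_coprimes (Nat.Coprime.pow a e (by norm_num : Nat.Coprime 2 3))
    (orderOf_dvd_of_pow_eq_one (hexp Nat.prime_two ha f hf _))
    (orderOf_dvd_of_pow_eq_one (hexp Nat.prime_three he g hg _))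

/-- If `p` exceeds every prime factor of `m`, then `SL(2, ℤ/mℤ)` and `SL(2, ℤ/p^eℤ)` have no
nontrivial common quotient. -/
lemma subsingleton_of_common_quotient {m p e : ℕ} (hm : m ≠ 0) (hp : p.Prime) (he : e ≠ 0)
    (hlt : ∀ q, q.Prime → q ∣ m → q < p) {Q : Type*} [Group Q]
    (f : SL2 (ZMod m) →* Q) (hf : Function.Surjective f)
    (g : SL2 (ZMod (p ^ e)) →* Q) (hg : Function.Surjective g) : Subsingleton Q := by
  have : NeZero m := ⟨hm⟩
  rcases eq_or_ne p 3 with rfl | hp3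
  · obtain ⟨a, rfl⟩ : ∃ a, m = 2 ^ a := ⟨_, Nat.eq_prime_pow_of_unique_prime_dvd hm
      fun hq hqm ↦ le_antisymm (Nat.le_of_lt_succ (hlt _ hq hqm)) hq.two_le⟩
    rcases eq_or_ne a 0 with rfl | ha
    · have : Subsingleton (ZMod (2 ^ 0)) := by rw [pow_zero]; infer_instance
      exact hf.subsingleton
    · exact subsingleton_of_two_three ha he f hf g hg
  · have hA : g (Amat 1) = 1 := by
      rw [← orderOf_eq_one_iff]
      refine Nat.eq_one_of_dvd_coprimes (Nat.Coprime.pow_left e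
        ((hp.coprime_iff_not_dvd).2 (not_dvd_card_SL2_zmod hp hm hp3 hlt)))
        (orderOf_dvd_of_pow_eq_one (by rw [← map_pow, Amat_one_pow_self, map_one])) ?_
      obtain ⟨x, hx⟩ := hf (g (Amat 1))
      rw [← hx]
      exact (orderOf_map_dvd f x).trans (orderOf_dvd_natCard x)
    refine subsingleton_of_forall_eq 1 fun y ↦ ?_
    obtain ⟨x, rfl⟩ := hg y
    exact monoidHom_eq_one_of_Amat hp he g hA x

/-- A subdirect product of two groups without common nontrivial quotient is the full product. -/
lemma Subgroup.eq_top_of_subsingleton_common_quotient {G H : Type} [Group G] [Group H]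
    {I : Subgroup (G × H)} (h₁ : Function.Surjective (Prod.fst ∘ I.subtype))
    (h₂ : Function.Surjective (Prod.snd ∘ I.subtype))
    (hQ : ∀ (Q : Type) [Group Q] (f : G →* Q) (g : H →* Q), Function.Surjective f →
      Function.Surjective g → Subsingleton Q) : I = ⊤ := by
  have := normal_goursatFst h₁
  have := normal_goursatSnd h₂
  obtain ⟨e, -⟩ := goursat_surjective h₁ h₂
  have hsub := hQ (H ⧸ I.goursatSnd) (e.toMonoidHom.comp (QuotientGroup.mk' _))
    (QuotientGroup.mk' _) (e.surjective.comp (QuotientGroup.mk'_surjective _))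
    (QuotientGroup.mk'_surjective _)
  have hsnd : I.goursatSnd = ⊤ := QuotientGroup.subsingleton_iff.1 hsub
  have hfst : I.goursatFst = ⊤ := QuotientGroup.subsingleton_iff.1 e.toEquiv.subsingleton
  have hle := I.goursatFst_prod_goursatSnd_le
  rwa [hsnd, hfst, Subgroup.top_prod_top, top_le_iff] at hle

lemma injective_map_prod_map {l m n : ℕ} [NeZero l] (hml : m ∣ l) (hnl : n ∣ l)
    (hl : l ∣ Nat.lcm m n) :
    Function.Injective ((SpecialLinearGroup.map (n := Fin 2) (ZMod.castHom hml (ZMod m))).prod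
      (SpecialLinearGroup.map (ZMod.castHom hnl (ZMod n)))) := by
  intro x y hxy
  obtain ⟨h1, h2⟩ := Prod.ext_iff.1 hxy
  ext i j
  rw [← sub_eq_zero, ← ZMod.natCast_zmod_val (x.1 i j - _), ZMod.natCast_eq_zero_iff]
  refine hl.trans (Nat.lcm_dvd ?_ ?_)
  · rw [← ZMod.castHom_eq_zero_iff hml, map_sub, sub_eq_zero]
    exact SpecialLinearGroup.apply_eq_of_map_eq h1 i j
  · rw [← ZMod.castHom_eq_zero_iff hnl, map_sub, sub_eq_zero]
    exact SpecialLinearGroup.apply_eq_of_map_eq h2 i j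

lemma map_castHom_map_castHom {l m n : ℕ} (hml : m ∣ l) (hnm : n ∣ m)
    (K : Subgroup (SL2 (ZMod l))) :
    (K.map (SpecialLinearGroup.map (ZMod.castHom hml (ZMod m)))).map
      (SpecialLinearGroup.map (ZMod.castHom hnm (ZMod n))) =
    K.map (SpecialLinearGroup.map (ZMod.castHom (hnm.trans hml) (ZMod n))) := by
  rw [Subgroup.map_map]
  congr 1
  ext x i j
  exact congrArg (fun φ : ZMod l →+* ZMod n ↦ φ (x.1 i j)) (ZMod.castHom_comp hnm hml)

lemma eq_top_of_map_ordProj_eq_top (l : ℕ) (hl : l ≠ 0) (K : Subgroup (SL2 (ZMod l)))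
    (hK : ∀ p n : ℕ, p.Prime → p ∣ l → n = p ^ l.factorization p → ∀ h : n ∣ l,
      K.map (SpecialLinearGroup.map (ZMod.castHom h (ZMod n))) = ⊤) : K = ⊤ := by
  induction l using Nat.strong_induction_on with
  | _ l ih =>
  have : NeZero l := ⟨hl⟩
  rcases eq_or_ne l 1 with rfl | hl1
  · exact Subgroup.ext fun x ↦ by simp [Subsingleton.elim x 1]
  have hne : l.primeFactors.Nonempty := Nat.nonempty_primeFactors.2 (by omega)
  obtain ⟨p, hpmem, hmax⟩ := l.primeFactors.exists_max_image id hne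
  have hp := Nat.prime_of_mem_primeFactors hpmem
  have hpl := Nat.dvd_of_mem_primeFactors hpmem
  have he : l.factorization p ≠ 0 := (hp.factorization_pos_of_dvd hl hpl).ne'
  set m := l / p ^ l.factorization p with hm
  have hml : m ∣ l := Nat.ordCompl_dvd l p
  have hnl : p ^ l.factorization p ∣ l := Nat.ordProj_dvd l p
  have hm0 : m ≠ 0 := (Nat.ordCompl_pos p hl).ne'
  have hpm : ¬ p ∣ m := Nat.not_dvd_ordCompl hp hl
  have hlt : ∀ q, q.Prime → q ∣ m → q < p := fun q hq hqm ↦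
    lt_of_le_of_ne (hmax q (Nat.mem_primeFactors.2 ⟨hq, hqm.trans hml, hl⟩))
      (by rintro rfl; exact hpm hqm)
  have hKm : K.map (SpecialLinearGroup.map (ZMod.castHom hml (ZMod m))) = ⊤ := by
    refine ih m (Nat.div_lt_self (Nat.pos_of_ne_zero hl) (Nat.one_lt_pow he hp.one_lt)) hm0 _ ?_
    intro q n hq hqm hn h
    rw [map_castHom_map_castHom]
    refine hK q n hq (hqm.trans hml) ?_ _
    rw [hn, hm, Nat.factorization_ordCompl, Finsupp.erase_ne (hlt q hq hqm).ne]
  have hKp := hK p _ hp hpl rfl hnl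
  set Φ := (SpecialLinearGroup.map (n := Fin 2) (ZMod.castHom hml (ZMod m))).prod
    (SpecialLinearGroup.map (ZMod.castHom hnl (ZMod (p ^ l.factorization p))))
  have hΦ : Function.Injective Φ := by
    refine injective_map_prod_map hml hnl ?_
    rw [Nat.Coprime.lcm_eq_mul (((hp.coprime_iff_not_dvd).2 hpm).symm.pow_right _), hm,
      Nat.div_mul_cancel hnl]
  have hI : K.map Φ = ⊤ := by
    refine Subgroup.eq_top_of_subsingleton_common_quotient ?_ ?_
      fun Q _ f g hf hg ↦ subsingleton_of_common_quotient hm0 hp he hlt f hf g hg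
    · intro x
      obtain ⟨k, hk, rfl⟩ := (hKm ▸ Subgroup.mem_top x :)
      exact ⟨⟨Φ k, k, hk, rfl⟩, rfl⟩
    · intro x
      obtain ⟨k, hk, rfl⟩ := (hKp ▸ Subgroup.mem_top x :)
      exact ⟨⟨Φ k, k, hk, rfl⟩, rfl⟩
  rw [← Subgroup.comap_map_eq_self_of_injective hΦ K, hI, Subgroup.comap_top]

/-- If a subgroup `K ≤ SL(2, ℤ/lℤ)` surjects onto `SL(2, ℤ/p^eℤ)` for every prime
power `p^e` exactly dividing `l`, then `K = SL(2, ℤ/lℤ)`. -/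
theorem stmt_10 (l : ℕ) (hl : 1 < l) (K : Subgroup (SL2 (ZMod l)))
    (hK : ∀ p : ℕ, p.Prime → p ∣ l →
      K.map (Matrix.SpecialLinearGroup.map
        (ZMod.castHom (Nat.ordProj_dvd l p) (ZMod (p ^ l.factorization p)))) = ⊤) :
    K = ⊤ := by
  refine eq_top_of_map_ordProj_eq_top l (by omega) K ?_
  rintro p n hp hpl rfl h
  exact hK p hp hpl
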